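/- The set of discord-breaking channels is not convex: there exist two CPTP maps Φ₁ and Φ₂ on 2×2 complex matrices, each a quantum-classical channel (hence each satisfies that (Φᵢ ⊗ id₂)(ρ) is classical-quantum for every state ρ on ℂ² ⊗ ℂ²), such that the convex combination Φ = (1/2)Φ₁ + (1/2)Φ₂ is a CPTP map but is not discord-breaking: there exists a state ρ on ℂ² ⊗ ℂ² for which (Φ ⊗ id₂)(ρ) is not classical-quantum. (Lemma 2.) -/

import Mathlib

open Matrix
open scoped Kronecker ComplexOrder

noncomputable section

/-- A state: positive semidefinite matrix with unit trace. -/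
def IsState {ι : Type} [Fintype ι] (ρ : Matrix ι ι ℂ) : Prop :=
  ρ.PosSemidef ∧ ρ.trace = 1

/-- The rank-one matrix `|ψ⟩⟨ψ| = ψ ψ†`. -/
def outer {d : ℕ} (ψ : Fin d → ℂ) : Matrix (Fin d) (Fin d) ℂ :=
  Matrix.of fun i j => ψ i * star (ψ j)

/-- A bipartite state (on `ℂ^{dA} ⊗ ℂ^{dB}`, Kronecker-product convention) is
classical-quantum with respect to subsystem `A` if it is a convex combination
`∑ k, p k • |ψ k⟩⟨ψ k| ⊗ σB k` with `{ψ k}` orthonormal in `ℂ^{dA}` and `σB k` states. -/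
def IsCQ {dA dB : ℕ} (ρ : Matrix (Fin dA × Fin dB) (Fin dA × Fin dB) ℂ) : Prop :=
  ∃ (n : ℕ) (ψ : Fin n → Fin dA → ℂ) (p : Fin n → ℝ)
    (σB : Fin n → Matrix (Fin dB) (Fin dB) ℂ),
      (∀ k l, star (ψ k) ⬝ᵥ ψ l = if k = l then 1 else 0) ∧
      (∀ k, 0 ≤ p k) ∧ (∑ k, p k = 1) ∧ (∀ k, IsState (σB k)) ∧
      ρ = ∑ k, (p k : ℂ) • (outer (ψ k) ⊗ₖ σB k)

/-- The `(a,b)` block (a matrix on the second factor) of a matrix on `Fin m × ι`. -/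
def blockA {m : ℕ} {ι : Type} (a b : Fin m) :
    Matrix (Fin m × ι) (Fin m × ι) ℂ →ₗ[ℂ] Matrix ι ι ℂ where
  toFun M := Matrix.of fun i j => M (a, i) (b, j)
  map_add' _ _ := rfl
  map_smul' _ _ := rfl

/-- The `(i,j)` slice (a matrix on the first factor) of a matrix on `Fin m × Fin d`. -/
def blockB {m d : ℕ} (i j : Fin d) :
    Matrix (Fin m × Fin d) (Fin m × Fin d) ℂ →ₗ[ℂ] Matrix (Fin m) (Fin m) ℂ where
  toFun M := Matrix.of fun a b => M (a, i) (b, j)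
  map_add' _ _ := rfl
  map_smul' _ _ := rfl

/-- `id_m ⊗ Φ`: the extension of `Φ` (acting on the second factor) by the identity
on the first factor.  On Kronecker products, `(id_m ⊗ Φ)(Y ⊗ₖ X) = Y ⊗ₖ Φ X`. -/
def idTensor {ι : Type} (m : ℕ) (Φ : Matrix ι ι ℂ →ₗ[ℂ] Matrix ι ι ℂ) :
    Matrix (Fin m × ι) (Fin m × ι) ℂ →ₗ[ℂ] Matrix (Fin m × ι) (Fin m × ι) ℂ where
  toFun M := Matrix.of fun p q => Φ (blockA p.1 q.1 M) p.2 q.2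
  map_add' M N := by
    ext ⟨a, i⟩ ⟨b, j⟩
    simp [Matrix.add_apply]
  map_smul' c M := by
    ext ⟨a, i⟩ ⟨b, j⟩
    simp [Matrix.smul_apply]

/-- `Φ ⊗ id_m`: the extension of `Φ` (acting on the first factor) by the identity
on the second factor.  On Kronecker products, `(Φ ⊗ id_m)(X ⊗ₖ Y) = Φ X ⊗ₖ Y`. -/
def tensorId {d : ℕ} (Φ : Matrix (Fin d) (Fin d) ℂ →ₗ[ℂ] Matrix (Fin d) (Fin d) ℂ)
    (m : ℕ) :
    Matrix (Fin d × Fin m) (Fin d × Fin m) ℂ →ₗ[ℂ]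
      Matrix (Fin d × Fin m) (Fin d × Fin m) ℂ where
  toFun M := Matrix.of fun p q => Φ (blockB p.2 q.2 M) p.1 q.1
  map_add' M N := by
    ext ⟨a, i⟩ ⟨b, j⟩
    simp [Matrix.add_apply]
  map_smul' c M := by
    ext ⟨a, i⟩ ⟨b, j⟩
    simp [Matrix.smul_apply]

/-- CPTP: trace preserving and completely positive (every extension `id_k ⊗ Φ`
maps positive semidefinite matrices to positive semidefinite matrices). -/
def IsCPTP {ι : Type} [Fintype ι] (Φ : Matrix ι ι ℂ →ₗ[ℂ] Matrix ι ι ℂ) : Prop :=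
  (∀ X, (Φ X).trace = X.trace) ∧
  ∀ k : ℕ, ∀ M : Matrix (Fin k × ι) (Fin k × ι) ℂ,
    M.PosSemidef → (idTensor k Φ M).PosSemidef

/-- Partial trace over the second (B) factor: `tr_B(X ⊗ₖ Y) = tr(Y) • X`. -/
def ptraceB {dA dB : ℕ} (M : Matrix (Fin dA × Fin dB) (Fin dA × Fin dB) ℂ) :
    Matrix (Fin dA) (Fin dA) ℂ :=
  Matrix.of fun a b => ∑ i, M (a, i) (b, i)

/-- The point channel with fixed state `σ`: `X ↦ tr(X) • σ`. -/
def pointChannel {d : ℕ} (σ : Matrix (Fin d) (Fin d) ℂ) :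
    Matrix (Fin d) (Fin d) ℂ →ₗ[ℂ] Matrix (Fin d) (Fin d) ℂ where
  toFun X := X.trace • σ
  map_add' X Y := by simp [Matrix.trace_add, add_smul]
  map_smul' c X := by simp [Matrix.trace_smul, smul_smul]

/-- A quantum-classical channel: `Φ(X) = ∑ k, tr(F k * X) • |ψ k⟩⟨ψ k|` for an
orthonormal family `{ψ k}` and a POVM `{F k}`. -/
def IsQCChannel {d : ℕ} (Φ : Matrix (Fin d) (Fin d) ℂ →ₗ[ℂ] Matrix (Fin d) (Fin d) ℂ) :
    Prop :=
  ∃ (n : ℕ) (ψ : Fin n → Fin d → ℂ) (F : Fin n → Matrix (Fin d) (Fin d) ℂ),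
    (∀ k l, star (ψ k) ⬝ᵥ ψ l = if k = l then 1 else 0) ∧
    (∀ k, (F k).PosSemidef) ∧ (∑ k, F k = 1) ∧
    (∀ X, Φ X = ∑ k, (F k * X).trace • outer (ψ k))

theorem blockA_apply {m : ℕ} {ι : Type} (a b : Fin m) (M : Matrix (Fin m × ι) (Fin m × ι) ℂ) :
    blockA a b M = Matrix.of fun i j => M (a, i) (b, j) := rfl

theorem blockB_apply {m d : ℕ} (i j : Fin d) (M : Matrix (Fin m × Fin d) (Fin m × Fin d) ℂ) :
    blockB i j M = Matrix.of fun a b => M (a, i) (b, j) := rfl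

theorem blockB_tensorId {d m : ℕ} (Φ : Matrix (Fin d) (Fin d) ℂ →ₗ[ℂ] Matrix (Fin d) (Fin d) ℂ)
    (i j : Fin m) (M : Matrix (Fin d × Fin m) (Fin d × Fin m) ℂ) :
    blockB i j (tensorId Φ m M) = Φ (blockB i j M) := rfl

theorem blockB_kronecker {m d : ℕ} (i j : Fin d) (X : Matrix (Fin m) (Fin m) ℂ)
    (Y : Matrix (Fin d) (Fin d) ℂ) : blockB i j (X ⊗ₖ Y) = Y i j • X := by
  ext a b
  simp [blockB_apply, mul_comm]

/-- The reduced matrix `tr_ι((1 ⊗ F) M)` of a matrix `M` on `α × ι`. -/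
def weightedPtrace {α ι : Type} [Fintype ι] (F : Matrix ι ι ℂ)
    (M : Matrix (α × ι) (α × ι) ℂ) : Matrix α α ℂ :=
  Matrix.of fun a b => (F * Matrix.of fun i j => M (a, i) (b, j)).trace

theorem Matrix.PosSemidef.weightedPtrace {α ι : Type} [Fintype α] [Fintype ι]
    {F : Matrix ι ι ℂ} (hF : F.PosSemidef)
    {M : Matrix (α × ι) (α × ι) ℂ} (hM : M.PosSemidef) :
    (weightedPtrace F M).PosSemidef := by
  classical
  obtain ⟨B, rfl⟩ : ∃ B : Matrix ι ι ℂ, F = Bᴴ * B := by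
    open scoped MatrixOrder in
    exact CStarAlgebra.nonneg_iff_eq_star_mul_self.mp hF.nonneg
  let K : ι → Matrix α (α × ι) ℂ := fun l => Matrix.of fun a p => if a = p.1 then B l p.2 else 0
  have h : _root_.weightedPtrace (Bᴴ * B) M = ∑ l, K l * M * (K l)ᴴ := by
    ext a b
    simp only [_root_.weightedPtrace, Matrix.trace, Matrix.diag, Matrix.mul_apply, Matrix.of_apply,
      Matrix.sum_apply, K, Matrix.conjTranspose_apply, Fintype.sum_prod_type, ite_mul, zero_mul,
      apply_ite star, star_zero, mul_ite, mul_zero, Finset.sum_ite_irrel, Finset.sum_const_zero,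
      Finset.sum_ite_eq, Finset.mem_univ, if_true, Finset.sum_mul]
    rw [Finset.sum_congr rfl fun i _ => Finset.sum_comm, Finset.sum_comm]
    refine Finset.sum_congr rfl fun l _ => Finset.sum_congr rfl fun i _ =>
      Finset.sum_congr rfl fun j _ => ?_
    ring
  rw [h]
  exact Matrix.posSemidef_sum _ fun l _ => hM.mul_mul_conjTranspose_same (K l)

theorem sum_trace_weightedPtrace {α ι κ : Type} [Fintype α] [Fintype ι] [Fintype κ]
    [DecidableEq ι] {F : κ → Matrix ι ι ℂ} (hF : ∑ k, F k = 1)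
    (M : Matrix (α × ι) (α × ι) ℂ) :
    ∑ k, (weightedPtrace (F k) M).trace = M.trace := by
  simp only [weightedPtrace, Matrix.trace, Matrix.diag, Matrix.of_apply]
  rw [Finset.sum_comm, Fintype.sum_prod_type]
  refine Finset.sum_congr rfl fun a _ => ?_
  change ∑ k, (F k * Matrix.of fun i j => M (a, i) (a, j)).trace = _
  rw [← Matrix.trace_sum, ← Matrix.sum_mul, hF, Matrix.one_mul]
  rfl

theorem outer_posSemidef {d : ℕ} (ψ : Fin d → ℂ) : (outer ψ).PosSemidef :=
  Matrix.posSemidef_vecMulVec_self_star ψ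

theorem trace_outer {d : ℕ} (ψ : Fin d → ℂ) : (outer ψ).trace = star ψ ⬝ᵥ ψ := by
  simp [outer, Matrix.trace, dotProduct, mul_comm]

theorem IsQCChannel.isCPTP {d : ℕ} {Φ : Matrix (Fin d) (Fin d) ℂ →ₗ[ℂ] Matrix (Fin d) (Fin d) ℂ}
    (h : IsQCChannel Φ) : IsCPTP Φ := by
  obtain ⟨n, ψ, F, hψ, hF, hF1, hΦ⟩ := h
  refine ⟨fun X => ?_, fun k M hM => ?_⟩
  · simp_rw [hΦ, Matrix.trace_sum, Matrix.trace_smul, trace_outer, hψ, if_true, smul_eq_mul,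
      mul_one]
    rw [← Matrix.trace_sum, ← Matrix.sum_mul, hF1, Matrix.one_mul]
  · have h : idTensor k Φ M = ∑ l, weightedPtrace (F l) M ⊗ₖ outer (ψ l) := by
      ext ⟨a, i⟩ ⟨b, j⟩
      simp [idTensor, hΦ, Matrix.sum_apply, weightedPtrace, blockA_apply]
    rw [h]
    exact Matrix.posSemidef_sum _ fun l _ =>
      ((hF l).weightedPtrace hM).kronecker (outer_posSemidef (ψ l))

theorem exists_isState_eq_trace_smul {m : ℕ} [NeZero m] {σ : Matrix (Fin m) (Fin m) ℂ}
    (hσ : σ.PosSemidef) :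
    ∃ τ, IsState τ ∧ σ = (σ.trace.re : ℂ) • τ := by
  have htr : (σ.trace.re : ℂ) = σ.trace :=
    Complex.ext rfl (Complex.le_def.mp hσ.trace_nonneg).2
  rw [htr]
  by_cases h : σ.trace = 0
  · refine ⟨outer (Pi.single 0 1), ⟨outer_posSemidef _, ?_⟩, ?_⟩
    · simp [trace_outer]
    · simp [hσ.trace_eq_zero_iff.mp h]
  · refine ⟨σ.trace⁻¹ • σ, ⟨hσ.smul (inv_nonneg.mpr hσ.trace_nonneg), ?_⟩, ?_⟩
    · simp [Matrix.trace_smul, h]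
    · simp [smul_smul, h]

theorem IsQCChannel.isCQ_tensorId {d m : ℕ} [NeZero m]
    {Φ : Matrix (Fin d) (Fin d) ℂ →ₗ[ℂ] Matrix (Fin d) (Fin d) ℂ} (h : IsQCChannel Φ)
    {ρ : Matrix (Fin d × Fin m) (Fin d × Fin m) ℂ} (hρ : IsState ρ) :
    IsCQ (tensorId Φ m ρ) := by
  obtain ⟨n, ψ, F, hψ, hF, hF1, hΦ⟩ := h
  let M : Matrix (Fin m × Fin d) (Fin m × Fin d) ℂ := ρ.submatrix Prod.swap Prod.swap
  have hM : M.PosSemidef := hρ.1.submatrix _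
  have hMtr : M.trace = 1 := by
    rw [← hρ.2]
    exact Equiv.sum_comp (Equiv.prodComm (Fin m) (Fin d)) fun p => ρ p p
  have hσ l : (weightedPtrace (F l) M).PosSemidef := (hF l).weightedPtrace hM
  choose τ hτ hστ using fun l => exists_isState_eq_trace_smul (hσ l)
  refine ⟨n, ψ, fun l => (weightedPtrace (F l) M).trace.re, τ, hψ,
    fun l => (Complex.le_def.mp (hσ l).trace_nonneg).1, ?_, hτ, ?_⟩
  · rw [← Complex.re_sum, sum_trace_weightedPtrace hF1, hMtr, Complex.one_re]
  · simp_rw [← Matrix.kronecker_smul, ← hστ]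
    ext ⟨a, i⟩ ⟨b, j⟩
    simp [tensorId, hΦ, Matrix.sum_apply, weightedPtrace, blockB_apply, M, mul_comm]

theorem IsCPTP.midpoint {ι : Type} [Fintype ι] {Φ₁ Φ₂ : Matrix ι ι ℂ →ₗ[ℂ] Matrix ι ι ℂ}
    (h₁ : IsCPTP Φ₁) (h₂ : IsCPTP Φ₂) : IsCPTP ((1 / 2 : ℂ) • Φ₁ + (1 / 2 : ℂ) • Φ₂) := by
  refine ⟨fun X => ?_, fun k M hM => ?_⟩
  · simp only [LinearMap.add_apply, LinearMap.smul_apply, Matrix.trace_add, Matrix.trace_smul,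
      h₁.1, h₂.1, smul_eq_mul]
    ring
  · have h : (0 : ℂ) ≤ 1 / 2 := by positivity
    exact ((h₁.2 k M hM).smul h).add ((h₂.2 k M hM).smul h)

theorem outer_mul_outer {d : ℕ} (ψ φ : Fin d → ℂ) :
    outer ψ * outer φ = (star ψ ⬝ᵥ φ) • Matrix.vecMulVec ψ (star φ) := by
  change Matrix.vecMulVec ψ (star ψ) * Matrix.vecMulVec φ (star φ) = _
  rw [Matrix.vecMulVec_mul_vecMulVec, Matrix.vecMulVec_smul]

/-- The slices of a classical-quantum state on the first factor commute. -/
theorem IsCQ.commute_blockB {dA dB : ℕ} {ρ : Matrix (Fin dA × Fin dB) (Fin dA × Fin dB) ℂ}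
    (h : IsCQ ρ) (i j k l : Fin dB) : Commute (blockB i j ρ) (blockB k l ρ) := by
  obtain ⟨n, ψ, p, σ, hψ, -, -, -, rfl⟩ := h
  have hb (i j : Fin dB) : blockB i j (∑ r, (p r : ℂ) • (outer (ψ r) ⊗ₖ σ r)) =
      ∑ r, ((p r : ℂ) * σ r i j) • outer (ψ r) := by
    simp only [map_sum, map_smul, blockB_kronecker, smul_smul]
  rw [hb, hb]
  refine Commute.sum_left _ _ _ fun r _ => Commute.sum_right _ _ _ fun s _ =>
    (Commute.smul_left (Commute.smul_right ?_ _) _)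
  rcases eq_or_ne r s with rfl | hrs
  · exact Commute.refl _
  · simp [Commute, SemiconjBy, outer_mul_outer, hψ, hrs, hrs.symm]

/-- The measure-and-prepare map `X ↦ ∑ k, tr(F k * X) • |ψ k⟩⟨ψ k|`. -/
def qcMap {d n : ℕ} (ψ : Fin n → Fin d → ℂ) (F : Fin n → Matrix (Fin d) (Fin d) ℂ) :
    Matrix (Fin d) (Fin d) ℂ →ₗ[ℂ] Matrix (Fin d) (Fin d) ℂ where
  toFun X := ∑ k, (F k * X).trace • outer (ψ k)
  map_add' X Y := by simp [Matrix.mul_add, add_smul, Finset.sum_add_distrib]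
  map_smul' c X := by simp [smul_smul, Finset.smul_sum]

/-- A rational orthonormal basis of `ℂ²` distinct from the standard one. -/
def rotatedBasis : Fin 2 → Fin 2 → ℂ := ![![3 / 5, 4 / 5], ![4 / 5, -3 / 5]]

theorem isQCChannel_qcMap_one : IsQCChannel (qcMap (d := 2) (n := 1) ![![1, 0]] ![1]) := by
  refine ⟨1, _, _, fun k l => ?_, fun k => ?_, by simp, fun X => rfl⟩
  · fin_cases k; fin_cases l; simp [dotProduct]
  · fin_cases k; simpa using Matrix.PosSemidef.one

theorem isQCChannel_qcMap_rotatedBasis :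
    IsQCChannel (qcMap rotatedBasis ![outer ![1, 0], outer ![0, 1]]) := by
  refine ⟨2, _, _, fun k l => ?_, fun k => ?_, ?_, fun X => rfl⟩
  · fin_cases k <;> fin_cases l <;> simp [rotatedBasis, dotProduct, map_ofNat] <;> norm_num
  · fin_cases k <;> exact outer_posSemidef _
  · ext i j
    fin_cases i <;> fin_cases j <;> simp [outer]

/-- Lemma 2: the set of discord-breaking channels is not convex. -/
theorem stmt_6 :
    ∃ Φ₁ Φ₂ : Matrix (Fin 2) (Fin 2) ℂ →ₗ[ℂ] Matrix (Fin 2) (Fin 2) ℂ,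
      IsCPTP Φ₁ ∧ IsCPTP Φ₂ ∧ IsQCChannel Φ₁ ∧ IsQCChannel Φ₂ ∧
      (∀ ρ : Matrix (Fin 2 × Fin 2) (Fin 2 × Fin 2) ℂ, IsState ρ →
        IsCQ (tensorId Φ₁ 2 ρ) ∧ IsCQ (tensorId Φ₂ 2 ρ)) ∧
      IsCPTP ((1 / 2 : ℂ) • Φ₁ + (1 / 2 : ℂ) • Φ₂) ∧
      ∃ ρ : Matrix (Fin 2 × Fin 2) (Fin 2 × Fin 2) ℂ, IsState ρ ∧
        ¬ IsCQ (tensorId ((1 / 2 : ℂ) • Φ₁ + (1 / 2 : ℂ) • Φ₂) 2 ρ) := by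
  have h₁ := isQCChannel_qcMap_one
  have h₂ := isQCChannel_qcMap_rotatedBasis
  refine ⟨_, _, h₁.isCPTP, h₂.isCPTP, h₁, h₂,
    fun ρ hρ => ⟨h₁.isCQ_tensorId hρ, h₂.isCQ_tensorId hρ⟩, h₁.isCPTP.midpoint h₂.isCPTP,
    (1 / 2 : ℂ) • (outer ![1, 0] ⊗ₖ outer ![1, 0] + outer ![0, 1] ⊗ₖ outer ![0, 1]),
    ⟨?_, ?_⟩, fun h => ?_⟩
  · exact (((outer_posSemidef _).kronecker (outer_posSemidef _)).add
      ((outer_posSemidef _).kronecker (outer_posSemidef _))).smul (by positivity)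
  · simp only [Matrix.trace_smul, Matrix.trace_add, Matrix.trace_kronecker, trace_outer]
    simp [dotProduct]
    norm_num
  · have hc := congrFun (congrFun (h.commute_blockB 0 0 1 1) 0) 1
    simp only [blockB_tensorId, map_smul, map_add, blockB_kronecker] at hc
    simp [Matrix.mul_apply, qcMap, outer, rotatedBasis, Matrix.trace, map_ofNat] at hc
    norm_num at hc
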